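/- Fix an integer k ≥ 1, τ ∈ (0,1), and ε > 0. Define β_k^τ = sup_{s ≥ 0} (s − s/τ + E[min(Pois(sk), k)]/(τk)), where for λ ≥ 0, E[min(Pois(λ), k)] denotes Σ_{j=0}^∞ min(j, k) e^{−λ} λ^j / j!. Then there exist an integer n ≥ 1, probabilities p_1,…,p_n ∈ [0,1], and values v_1 ≥ v_2 ≥ ⋯ ≥ v_n with v_i ≥ τ for all i, such that, defining for S ⊆ {1,…,n} (with B_1,…,B_n independent Bernoulli random variables with P(B_i = 1) = p_i) the simultaneous-offering reward R(S) := E[Σ_{i∈S} v_i B_i − max(Σ_{i∈S} B_i − k, 0)], one has max_{S⊆{1,…,n}} R(S) > 0 and, for every m ∈ {0,1,…,n}, R({1,…,m}) ≤ (β_k^τ + ε) · max_{S⊆{1,…,n}} R(S). -/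

import Mathlib

open Finset

/-- The probability that the set of `1`-coordinates of a vector of independent Bernoulli
random variables with means `p` equals exactly `A`. -/
noncomputable def bernWeight {n : ℕ} (p : Fin n → ℝ) (A : Finset (Fin n)) : ℝ :=
  (∏ i ∈ A, p i) * ∏ i ∈ Aᶜ, (1 - p i)

/-- `E[min(Pois(λ), k)] = ∑_{j=0}^∞ min(j,k) e^{−λ} λ^j / j!`. -/
noncomputable def poisMin (k : ℕ) (lam : ℝ) : ℝ :=
  ∑' j : ℕ, min (j : ℝ) (k : ℝ) * (Real.exp (-lam) * lam ^ j / (Nat.factorial j : ℝ))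

/-- Expected reward of sending simultaneous offers to the set `S` with capacity `k`:
`E[∑_{i∈S} v_i B_i − max(∑_{i∈S} B_i − k, 0)]` for independent Bernoulli `B_i` of means `p i`. -/
noncomputable def simReward {n : ℕ} (k : ℕ) (p v : Fin n → ℝ) (S : Finset (Fin n)) : ℝ :=
  ∑ A : Finset (Fin n),
    bernWeight p A * ((∑ i ∈ S ∩ A, v i) - max (((S ∩ A).card : ℝ) - (k : ℝ)) 0)

open MeasureTheory ProbabilityTheory in
/-- The expectation of `min (N + j) k` for a Poisson random variable `N` of mean `r`. -/
noncomputable def poissonCapped (k j : ℕ) (r : NNReal) : ℝ :=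
  ∫ x, min ((x + j : ℕ) : ℝ) k ∂poissonMeasure r

theorem norm_min_natCast_le (k j : ℕ) : ‖min (j : ℝ) (k : ℝ)‖ ≤ k := by
  rw [Real.norm_of_nonneg (by positivity)]
  exact min_le_right _ _

open MeasureTheory ProbabilityTheory in
theorem poisMin_eq_poissonCapped (k : ℕ) (r : NNReal) :
    poisMin k r = poissonCapped k 0 r := by
  simp only [poissonCapped, poisMin, integral_poissonMeasure, smul_eq_mul, add_zero]
  exact tsum_congr fun j => mul_comm _ _

open MeasureTheory ProbabilityTheory in
theorem poissonCapped_le (k j : ℕ) (r : NNReal) : poissonCapped k j r ≤ k := by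
  refine (Real.le_norm_self _).trans ?_
  have h := norm_integral_le_of_norm_le_const (μ := poissonMeasure r)
    (f := fun x : ℕ => min ((x + j : ℕ) : ℝ) k)
    (Filter.Eventually.of_forall fun x => norm_min_natCast_le k (x + j))
  simpa [poissonCapped] using h

open MeasureTheory ProbabilityTheory in
theorem min_le_poissonCapped_zero (k j : ℕ) : min (j : ℝ) k ≤ poissonCapped k j 0 := by
  rw [poissonCapped, integral_poissonMeasure, tsum_eq_single 0]
  · simp
  · intro n hn
    simp [hn]

/-- A Poisson variable of mean `c` dominates a Bernoulli variable of mean `1 - exp (-c)`. -/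
theorem bernoulli_step_le_poissonCapped (k j : ℕ) (r c : NNReal) :
    Real.exp (-c) * poissonCapped k j r + (1 - Real.exp (-c)) * poissonCapped k (j + 1) r ≤
      poissonCapped k j (r + c) := by
  open MeasureTheory ProbabilityTheory in
  have hbdd : ∀ (s : NNReal) (i : ℕ),
      Integrable (fun x : ℕ => min ((x + i : ℕ) : ℝ) k) (poissonMeasure s) := fun s i =>
    Integrable.of_bound (by fun_prop) (k : ℝ)
      (Filter.Eventually.of_forall fun x => norm_min_natCast_le k (x + i))
  have hprod : Integrable (fun z : ℕ × ℕ => min ((z.1 + z.2 + j : ℕ) : ℝ) k)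
      ((poissonMeasure r).prod (poissonMeasure c)) :=
    Integrable.of_bound (by fun_prop) (k : ℝ)
      (Filter.Eventually.of_forall fun z => norm_min_natCast_le k (z.1 + z.2 + j))
  have hconv : poissonCapped k j (r + c) =
      ∫ x, ∫ y, min ((x + y + j : ℕ) : ℝ) k ∂poissonMeasure c ∂poissonMeasure r := by
    rw [poissonCapped, ← poissonMeasure_conv_poissonMeasure, Measure.conv,
      integral_map (by fun_prop) (by fun_prop), integral_prod _ hprod]
  have hzero : (poissonMeasure c).real {0}ᶜ = 1 - Real.exp (-c) := by
    rw [probReal_compl_eq_one_sub (by measurability), poissonMeasure_real_singleton]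
    simp
  have hinner : ∀ x : ℕ, Real.exp (-c) * min ((x + j : ℕ) : ℝ) k +
      (1 - Real.exp (-c)) * min ((x + (j + 1) : ℕ) : ℝ) k ≤
        ∫ y, min ((x + y + j : ℕ) : ℝ) k ∂poissonMeasure c := by
    intro x
    set a := min ((x + j : ℕ) : ℝ) k with ha
    set b := min ((x + (j + 1) : ℕ) : ℝ) k with hb
    have hind : Integrable (({0}ᶜ : Set ℕ).indicator fun _ => b - a) (poissonMeasure c) :=
      (integrable_const _).indicator (by measurability)
    have hval : Real.exp (-c) * a + (1 - Real.exp (-c)) * b =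
        ∫ y, (a + ({0}ᶜ : Set ℕ).indicator (fun _ => b - a) y) ∂poissonMeasure c := by
      rw [integral_add (integrable_const _) hind, integral_indicator_const _ (by measurability),
        hzero]
      simp
      ring
    rw [hval]
    refine integral_mono ((integrable_const _).add hind) ?_ fun y => ?_
    · refine (hbdd c (x + j)).congr (Filter.Eventually.of_forall fun y => ?_)
      simp only
      congr 2
      ring
    · rcases Nat.eq_zero_or_pos y with rfl | hy
      · simp [ha]
      · have hy0 : y ∈ ({0}ᶜ : Set ℕ) := by simp; omega
        simp only [Set.indicator_of_mem hy0, add_sub_cancel, hb]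
        refine min_le_min_right _ ?_
        exact_mod_cast (by omega : x + (j + 1) ≤ x + y + j)
  rw [hconv, poissonCapped, poissonCapped, ← integral_const_mul, ← integral_const_mul,
    ← integral_add ((hbdd r j).const_mul _) ((hbdd r (j + 1)).const_mul _)]
  exact integral_mono (((hbdd r j).const_mul _).add ((hbdd r (j + 1)).const_mul _))
    hprod.integral_prod_left hinner

theorem sum_bernWeight {n : ℕ} (p : Fin n → ℝ) : ∑ A, bernWeight p A = 1 := by
  simp only [bernWeight, ← Fintype.prod_add]
  simp

/-- The expectation of `φ` of the number of acceptances in `S`. -/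
noncomputable def bernCount {n : ℕ} (p : Fin n → ℝ) (φ : ℕ → ℝ) (S : Finset (Fin n)) : ℝ :=
  ∑ A, bernWeight p A * φ (S ∩ A).card

theorem bernCount_empty {n : ℕ} (p : Fin n → ℝ) (φ : ℕ → ℝ) : bernCount p φ ∅ = φ 0 := by
  simp [bernCount, ← Finset.sum_mul, sum_bernWeight]

theorem one_sub_mul_bernWeight_insert {n : ℕ} (p : Fin n → ℝ) {i : Fin n} {A : Finset (Fin n)}
    (hi : i ∉ A) : (1 - p i) * bernWeight p (insert i A) = p i * bernWeight p A := by
  have hA : Aᶜ = insert i (insert i A)ᶜ := by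
    ext x
    by_cases hx : x = i <;> simp [hx, hi]
  rw [bernWeight, bernWeight, prod_insert hi, hA, prod_insert (by simp)]
  ring

theorem sum_finset_eq_sum_erase {n : ℕ} (i : Fin n) (f : Finset (Fin n) → ℝ) :
    ∑ A, f A = ∑ A ∈ (univ.erase i).powerset, (f A + f (insert i A)) := by
  rw [← powerset_univ, ← insert_erase (mem_univ i), sum_powerset_insert (by simp),
    sum_add_distrib, insert_erase (mem_univ i)]

theorem bernCount_insert {n : ℕ} (p : Fin n → ℝ) (φ : ℕ → ℝ) {i : Fin n} {S : Finset (Fin n)}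
    (hi : i ∉ S) : bernCount p φ (insert i S) =
      (1 - p i) * bernCount p φ S + p i * bernCount p (fun j => φ (j + 1)) S := by
  simp only [bernCount]
  rw [sum_finset_eq_sum_erase i, sum_finset_eq_sum_erase i, sum_finset_eq_sum_erase i,
    mul_sum, mul_sum, ← sum_add_distrib]
  refine sum_congr rfl fun A hA => ?_
  have hiA : i ∉ A := fun h => by simpa using mem_powerset.1 hA h
  have h₁ : insert i S ∩ A = S ∩ A := insert_inter_of_notMem hiA
  have h₂ : S ∩ insert i A = S ∩ A := inter_insert_of_notMem hi
  have h₃ : (insert i S ∩ insert i A).card = (S ∩ A).card + 1 := by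
    rw [← insert_inter_distrib, card_insert_of_notMem (by simp [hi])]
  rw [h₁, h₂, h₃]
  linear_combination (φ ((S ∩ A).card + 1) - φ (S ∩ A).card) * one_sub_mul_bernWeight_insert p hiA

theorem bernCount_natCast {n : ℕ} (p : Fin n → ℝ) (S : Finset (Fin n)) (j : ℕ) :
    bernCount p (fun x => ((x + j : ℕ) : ℝ)) S = j + ∑ i ∈ S, p i := by
  induction S using Finset.induction_on generalizing j with
  | empty => simp [bernCount_empty]
  | insert i S hi ih =>
    have h : ∀ x, x + 1 + j = x + (j + 1) := fun x => by ring
    simp only [bernCount_insert p _ hi, sum_insert hi, h, ih]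
    push_cast
    ring

theorem bernCount_eq_card {n : ℕ} (p : Fin n → ℝ) (φ : ℕ → ℝ) (S : Finset (Fin n))
    (hS : ∀ i ∈ S, p i = 1) : bernCount p φ S = φ S.card := by
  induction S using Finset.induction_on generalizing φ with
  | empty => simp [bernCount_empty]
  | insert i S hi ih =>
    have ih' := ih (fun j => φ (j + 1)) fun x hx => hS x (mem_insert_of_mem hx)
    rw [bernCount_insert p _ hi, ih', hS i (mem_insert_self i S), card_insert_of_notMem hi]
    ring

theorem bernWeight_nonneg {n : ℕ} (p : Fin n → ℝ) (hp : ∀ i, p i ∈ Set.Icc (0 : ℝ) 1)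
    (A : Finset (Fin n)) : 0 ≤ bernWeight p A :=
  mul_nonneg (prod_nonneg fun i _ => (hp i).1) (prod_nonneg fun i _ => sub_nonneg.2 (hp i).2)

theorem bernCount_min_le {n : ℕ} (p : Fin n → ℝ) (hp : ∀ i, p i ∈ Set.Icc (0 : ℝ) 1) (k : ℕ)
    (S : Finset (Fin n)) : bernCount p (fun x => min (x : ℝ) k) S ≤ k := by
  calc bernCount p (fun x => min (x : ℝ) k) S ≤ ∑ A, bernWeight p A * k :=
        sum_le_sum fun A _ => mul_le_mul_of_nonneg_left (min_le_right _ _) (bernWeight_nonneg p hp A)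
    _ = k := by rw [← sum_mul, sum_bernWeight, one_mul]

theorem bernCount_min_le_poissonCapped {n : ℕ} (p : Fin n → ℝ) (c : NNReal) (k j : ℕ)
    (S : Finset (Fin n)) (hS : ∀ i ∈ S, p i = 1 - Real.exp (-c)) :
    bernCount p (fun x => min ((x + j : ℕ) : ℝ) k) S ≤ poissonCapped k j (S.card * c) := by
  induction S using Finset.induction_on generalizing j with
  | empty => simpa [bernCount_empty] using min_le_poissonCapped_zero k j
  | insert i S hi ih =>
    have ih' := ih (hS := fun x hx => hS x (mem_insert_of_mem hx))
    have h : ∀ x, x + 1 + j = x + (j + 1) := fun x => by ring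
    have he : Real.exp (-c) ≤ 1 := by simp
    rw [bernCount_insert p _ hi, hS i (mem_insert_self i S), card_insert_of_notMem hi]
    simp only [h, sub_sub_cancel]
    push_cast
    rw [add_mul, one_mul]
    refine le_trans ?_ (bernoulli_step_le_poissonCapped k j _ c)
    have h₁ := ih' j
    have h₂ := ih' (j + 1)
    push_cast at h₁ h₂
    gcongr

theorem simReward_const {n : ℕ} (k : ℕ) (p : Fin n → ℝ) (τ : ℝ) (S : Finset (Fin n)) :
    simReward k p (fun _ => τ) S =
      (τ - 1) * ∑ i ∈ S, p i + bernCount p (fun x => min (x : ℝ) k) S := by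
  have h := bernCount_natCast p S 0
  simp only [add_zero, Nat.cast_zero, zero_add] at h
  rw [← h, bernCount, bernCount, mul_sum, ← sum_add_distrib, simReward]
  refine sum_congr rfl fun A _ => ?_
  rw [sum_const, nsmul_eq_mul]
  rcases le_total ((S ∩ A).card : ℝ) k with hk | hk
  · rw [max_eq_right (by linarith), min_eq_left hk]
    ring
  · rw [max_eq_left (by linarith), min_eq_right hk]
    ring

theorem simReward_le_poisMin {n : ℕ} (k : ℕ) (p : Fin n → ℝ) (τ : ℝ) (c : NNReal)
    (S : Finset (Fin n)) (hS : ∀ i ∈ S, p i = 1 - Real.exp (-c)) :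
    simReward k p (fun _ => τ) S ≤
      (τ - 1) * (S.card * (1 - Real.exp (-c))) + poisMin k (S.card * c) := by
  have h := bernCount_min_le_poissonCapped p c k 0 S hS
  rw [← poisMin_eq_poissonCapped] at h
  push_cast at h
  rw [simReward_const, sum_congr rfl hS, sum_const, nsmul_eq_mul]
  simpa using h

theorem poisMin_zero (k : ℕ) : poisMin k 0 = 0 := by
  rw [poisMin, tsum_eq_single 0] <;> simp +contextual

theorem bddAbove_poisMin_ratio (k : ℕ) (τ : ℝ) (hτ : τ ∈ Set.Ioo (0 : ℝ) 1) :
    BddAbove ((fun s : ℝ => s - s / τ + poisMin k (s * k) / (τ * k)) '' Set.Ici (0 : ℝ)) := by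
  refine ⟨(k : ℝ) / (τ * k), ?_⟩
  rintro _ ⟨s, hs, rfl⟩
  have hs0 : (0 : ℝ) ≤ s := hs
  have h₁ : s ≤ s / τ := le_div_self hs0 hτ.1 hτ.2.le
  have h₂ : poisMin k (s * k) ≤ k := by
    have h := poisMin_eq_poissonCapped k (⟨s, hs0⟩ * k)
    exact h.trans_le (poissonCapped_le _ _ _)
  have h₃ : poisMin k (s * k) / (τ * k) ≤ k / (τ * k) :=
    div_le_div_of_nonneg_right h₂ (mul_nonneg hτ.1.le k.cast_nonneg)
  simp only
  linarith

theorem poisMin_le_sSup (k : ℕ) (hk : 0 < k) (τ : ℝ) (hτ : τ ∈ Set.Ioo (0 : ℝ) 1) (l : ℝ)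
    (hl : 0 ≤ l) : (τ - 1) * l + poisMin k l ≤
      sSup ((fun s : ℝ => s - s / τ + poisMin k (s * k) / (τ * k)) '' Set.Ici (0 : ℝ)) *
        (τ * k) := by
  have hk' : (0 : ℝ) < k := Nat.cast_pos.2 hk
  have hτ0 := hτ.1
  rw [← div_le_iff₀ (by positivity)]
  refine le_csSup (bddAbove_poisMin_ratio k τ hτ) ⟨l / k, div_nonneg hl hk'.le, ?_⟩
  simp only [div_mul_cancel₀ l hk'.ne']
  field_simp

theorem one_sub_exp_neg_ge (c : ℝ) (hc : 0 ≤ c) : c - c ^ 2 ≤ 1 - Real.exp (-c) := by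
  have h : Real.exp (-c) ≤ 1 / (1 + c) := by
    rw [Real.exp_neg, ← one_div]
    exact one_div_le_one_div_of_le (by linarith) (by linarith [Real.add_one_le_exp c])
  have h' : 1 / (1 + c) ≤ 1 - c + c ^ 2 := by
    rw [div_le_iff₀ (by linarith)]
    nlinarith [pow_nonneg hc 3]
  linarith

theorem simReward_of_forall_eq_one {n : ℕ} (k : ℕ) (p : Fin n → ℝ) (τ : ℝ) (S : Finset (Fin n))
    (hS : ∀ i ∈ S, p i = 1) (hcard : S.card = k) : simReward k p (fun _ => τ) S = τ * k := by
  rw [simReward_const, bernCount_eq_card p _ S hS, sum_congr rfl hS, sum_const, hcard]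
  simp
  ring

theorem simReward_nonpos {n : ℕ} (k : ℕ) (p : Fin n → ℝ) (hp : ∀ i, p i ∈ Set.Icc (0 : ℝ) 1)
    (τ : ℝ) (S : Finset (Fin n)) (hS : (k : ℝ) ≤ (1 - τ) * ∑ i ∈ S, p i) :
    simReward k p (fun _ => τ) S ≤ 0 := by
  rw [simReward_const]
  linarith [bernCount_min_le p hp k S]

theorem exists_intensity (τ ε : ℝ) (k : ℕ) (hτ : τ ∈ Set.Ioo (0 : ℝ) 1) (hε : 0 < ε) :
    ∃ (N : ℕ) (c : NNReal), (k : ℝ) ≤ (1 - τ) * (N * (1 - Real.exp (-c))) ∧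
      ∀ m : ℕ, m ≤ N → m * (c - (1 - Real.exp (-c))) ≤ ε := by
  have hτ' : 0 < 1 - τ := sub_pos.2 hτ.2
  set L : ℝ := k / (1 - τ) + 1 with hL
  have hL0 : 0 < L := by positivity
  obtain ⟨N, hN⟩ := exists_nat_gt (L ^ 2 / min 1 ε)
  have hδ : 0 < min 1 ε := lt_min one_pos hε
  have hN0 : (0 : ℝ) < N := lt_of_le_of_lt (by positivity) hN
  have herr : L ^ 2 / N ≤ min 1 ε := by
    rw [div_lt_iff₀ hδ] at hN
    rw [div_le_iff₀ hN0]
    linarith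
  have hc0 : 0 ≤ L / N := by positivity
  have hexp := one_sub_exp_neg_ge (L / N) hc0
  have hsq : N * (L / N) ^ 2 = L ^ 2 / N := by field_simp
  refine ⟨N, ⟨L / N, hc0⟩, ?_, fun m hm => ?_⟩
  · change (k : ℝ) ≤ (1 - τ) * (N * (1 - Real.exp (-(L / N))))
    have h : L - 1 ≤ N * (1 - Real.exp (-(L / N))) := by
      calc L - 1 ≤ L - L ^ 2 / N := by linarith [min_le_left 1 ε]
        _ = N * (L / N - (L / N) ^ 2) := by rw [mul_sub, hsq]; field_simp
        _ ≤ _ := by gcongr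
    calc (k : ℝ) = (1 - τ) * (L - 1) := by rw [hL]; field_simp; ring
      _ ≤ _ := by gcongr
  · change m * (L / N - (1 - Real.exp (-(L / N)))) ≤ ε
    calc m * (L / N - (1 - Real.exp (-(L / N)))) ≤ m * (L / N) ^ 2 := by gcongr; linarith
      _ ≤ N * (L / N) ^ 2 := by gcongr
      _ ≤ ε := by rw [hsq]; exact herr.trans (min_le_right _ _)

/-- **Upper bound for value-ordered policies (Theorem: simul_upper_bound).**
For every `ε > 0` there is a `τ`-bounded instance on which every value-ordered policy
(a prefix of the candidates sorted in decreasing value) earns at most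
`(β_k^τ + ε)` times the optimal simultaneous-offering reward, where
`β_k^τ = sup_{s ≥ 0} (s − s/τ + E[min(Pois(sk),k)]/(τk))`. -/
theorem stmt12 (k : ℕ) (hk : 0 < k) (τ ε : ℝ) (hτ : τ ∈ Set.Ioo (0:ℝ) 1) (hε : 0 < ε) :
    ∃ (n : ℕ) (_ : 0 < n) (p v : Fin n → ℝ),
      (∀ i, p i ∈ Set.Icc (0:ℝ) 1) ∧
      (∀ i j : Fin n, i ≤ j → v j ≤ v i) ∧ (∀ i, τ ≤ v i) ∧
      0 < (⨆ S : Finset (Fin n), simReward k p v S) ∧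
      ∀ m : ℕ, m ≤ n →
        simReward k p v (univ.filter (fun i : Fin n => (i:ℕ) < m)) ≤
          (sSup ((fun s : ℝ => s - s/τ + poisMin k (s*k) / (τ*k)) '' Set.Ici (0:ℝ)) + ε) *
            ⨆ S : Finset (Fin n), simReward k p v S := by
  have hk' : (0 : ℝ) < k := Nat.cast_pos.2 hk
  have hτ0 := hτ.1
  have hτ1 := hτ.2
  obtain ⟨N, c, hlarge, herr⟩ := exists_intensity τ (ε * (τ * k)) k hτ (by positivity)
  have hq : 1 - Real.exp (-c) ∈ Set.Icc (0 : ℝ) 1 :=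
    ⟨by simp, by linarith [Real.exp_pos (-(c : ℝ))]⟩
  set p : Fin (N + k) → ℝ := fun i => if (i : ℕ) < N then 1 - Real.exp (-c) else 1 with hpdef
  set β := sSup ((fun s : ℝ => s - s / τ + poisMin k (s * k) / (τ * k)) '' Set.Ici (0 : ℝ))
  have hp : ∀ i, p i ∈ Set.Icc (0 : ℝ) 1 := fun i => by
    simp only [hpdef]
    split_ifs
    exacts [hq, ⟨zero_le_one, le_rfl⟩]
  have hβ : 0 ≤ β :=
    le_csSup (bddAbove_poisMin_ratio k τ hτ) ⟨0, Set.self_mem_Ici, by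
      simp [poisMin_zero]⟩
  have hopt : τ * k ≤ ⨆ S : Finset (Fin (N + k)), simReward k p (fun _ => τ) S := by
    rw [← simReward_of_forall_eq_one k p τ (univ.map (Fin.natAddEmb N)) (by simp [hpdef])
      (by simp)]
    exact le_ciSup (f := simReward k p fun _ => τ) (Set.finite_range _).bddAbove _
  refine ⟨N + k, by omega, p, fun _ => τ, hp, fun _ _ _ => le_rfl, fun _ => le_rfl,
    lt_of_lt_of_le (by positivity) hopt, fun m hm => ?_⟩
  refine le_trans ?_ (mul_le_mul_of_nonneg_left hopt (by linarith))
  have hprefix : ∀ l ≤ N, ∀ i ∈ univ.filter (fun i : Fin (N + k) => (i : ℕ) < l),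
      p i = 1 - Real.exp (-c) := fun l hl i hi =>
    if_pos ((mem_filter.1 hi).2.trans_le hl)
  rcases le_total m N with hmN | hmN
  · have h := simReward_le_poisMin k p τ c _ (hprefix m hmN)
    rw [Fin.card_filter_val_lt, min_eq_right hm] at h
    have h₁ := poisMin_le_sSup k hk τ hτ (m * c) (by positivity)
    have h₂ := herr m hmN
    have h₃ : 0 ≤ m * (c - (1 - Real.exp (-c))) :=
      mul_nonneg m.cast_nonneg (by linarith [Real.add_one_le_exp (-(c : ℝ))])
    nlinarith [mul_nonneg hτ0.le h₃]
  · refine (simReward_nonpos k p hp τ _ ?_).trans (by positivity)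
    refine hlarge.trans (mul_le_mul_of_nonneg_left ?_ (by linarith))
    calc N * (1 - Real.exp (-c))
        = ∑ i ∈ univ.filter (fun i : Fin (N + k) => (i : ℕ) < N), p i := by
          rw [sum_congr rfl (hprefix N le_rfl), sum_const, Fin.card_filter_val_lt]
          simp
      _ ≤ ∑ i ∈ univ.filter (fun i : Fin (N + k) => (i : ℕ) < m), p i :=
          sum_le_sum_of_subset_of_nonneg
            (monotone_filter_right _ fun i _ hi => lt_of_lt_of_le hi hmN)
            fun i _ _ => (hp i).1
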